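/- Let Z := {g·r_n : g ∈ SL_n(ℂ)} ⊆ W_n = ⨁_{i=1}^n Λ^i ℂ^n be the orbit of r_n = ⨁_{i=1}^n e_1∧…∧e_i, where g·r_n = ⨁_{i=1}^n (g e_1)∧…∧(g e_i), and let Z̄ be the Zariski closure of Z in W_n. Then dim(Z̄ ∖ Z) + 2 ≤ dim(Z); that is, the boundary of the orbit of r_n has codimension at least 2. -/

import Mathlib

open Matrix Filter Topology

noncomputable section

/-- The index set of the standard basis of `Λ^k ℂ^n`: subsets of `{1,…,n}` of size `k`. -/
abbrev SubK (n k : ℕ) := {C : Finset (Fin n) // C.card = k}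

/-- The increasing enumeration of a size-`k` subset of `{1,…,n}`. -/
def enumK {n k : ℕ} (C : SubK n k) (a : Fin k) : Fin n :=
  (C.1.orderIsoOfFin C.2 a : Fin n)

/-- The `k`-th exterior power `Λ^k ℂ^n`, in the coordinates given by its standard basis
`⋀_{i∈C} e_i`, `C ⊆ {1,…,n}`, `|C| = k`. -/
abbrev ExtP (n k : ℕ) := SubK n k → ℂ

/-- The standard basis vector `e_i` of `ℂ^n`. -/
def stdVec {n : ℕ} (i : Fin n) : Fin n → ℂ := Pi.single i 1

/-- The wedge `v_1 ∧ … ∧ v_k ∈ Λ^k ℂ^n` of a family of vectors, in standard coordinates: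
its coordinate along the basis vector `⋀_{i∈C} e_i` is the determinant of the `k×k`
matrix of the `C`-coordinates of `v_1,…,v_k`. -/
def wedgeFam {n : ℕ} (k : ℕ) (v : Fin k → (Fin n → ℂ)) : ExtP n k :=
  fun C => Matrix.det (Matrix.of fun a b : Fin k => v b (enumK C a))

/-- `⋀_{i∈C} e_i`, the wedge of the standard basis vectors indexed by `C`, taken in
increasing order of indices. -/
def wedgeBasis {n : ℕ} (k : ℕ) (C : Finset (Fin n)) (h : C.card = k) : ExtP n k :=
  wedgeFam k (fun a => stdVec (C.orderIsoOfFin h a))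

/-- `⋀_{i∈D} (g e_i)`, the wedge of the columns of `g` indexed by `D`, taken in
increasing order of indices. -/
def colWedge {n : ℕ} (k : ℕ) (g : Matrix (Fin n) (Fin n) ℂ) (D : Finset (Fin n))
    (h : D.card = k) : ExtP n k :=
  wedgeFam k (fun a => g.mulVec (stdVec (D.orderIsoOfFin h a)))

/-- The minor of `g` with rows `C` and columns `D` (both of size `k`, in increasing
order of indices). -/
def gminor {n : ℕ} (k : ℕ) (g : Matrix (Fin n) (Fin n) ℂ) (C D : SubK n k) : ℂ :=
  Matrix.det (Matrix.of fun a b : Fin k => g (enumK C a) (enumK D b))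

/-- The action of `g` on `Λ^k ℂ^n` (the `k`-th exterior power of the standard action of
`g` on `ℂ^n`), in standard coordinates: the matrix of `Λ^k g` in the standard basis is
the `k`-th compound matrix of `g`, whose entries are the `k×k` minors of `g`. -/
def extAct {n : ℕ} (k : ℕ) (g : Matrix (Fin n) (Fin n) ℂ) (x : ExtP n k) : ExtP n k :=
  fun C => ∑ D : SubK n k, gminor k g C D * x D

/-- `e_1 ∧ … ∧ e_{i}`, the wedge of an initial segment of the standard basis, an element
of `Λ^i ℂ^n`; here the index `i` runs through `1,…,n` as `(i:ℕ)+1` for `i : Fin n`.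
These are the components of the point `r_n ∈ W_n = ⨁_{i=1}^n Λ^i ℂ^n`. -/
def rComp {n : ℕ} (i : Fin n) : ExtP n ((i : ℕ) + 1) :=
  wedgeBasis _ (Finset.Iic i) (by simp)

/-- The vanishing ideal `I(Y)` of a subset `Y` of `ℂ^ι`: all polynomials in the
coordinates vanishing on `Y`. -/
def vanIdeal {ι : Type*} (Y : Set (ι → ℂ)) : Ideal (MvPolynomial ι ℂ) where
  carrier := {p | ∀ y ∈ Y, MvPolynomial.eval y p = 0}
  add_mem' := by
    intro a b ha hb y hy
    simp [map_add, ha y hy, hb y hy]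
  zero_mem' := by intro y hy; simp
  smul_mem' := by
    intro c p hp y hy
    simp [smul_eq_mul, _root_.map_mul, hp y hy]

/-- The Zariski closure of a subset of `ℂ^ι`: the common zero set of its vanishing
ideal. -/
def zCl {ι : Type*} (Y : Set (ι → ℂ)) : Set (ι → ℂ) :=
  {x | ∀ p ∈ vanIdeal Y, MvPolynomial.eval x p = 0}

/-- The dimension of a subset `Y` of `ℂ^ι`: the Krull dimension of the quotient of the
polynomial ring by the vanishing ideal `I(Y)`. -/
def sDim {ι : Type*} (Y : Set (ι → ℂ)) : WithBot (WithTop ℕ) :=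
  ringKrullDim (MvPolynomial ι ℂ ⧸ vanIdeal Y)

/-- Index type for the standard basis of `W_n = ⨁_{i=1}^n Λ^i ℂ^n`. -/
abbrev RIdx (n : ℕ) := Σ i : Fin n, SubK n ((i : ℕ) + 1)

/-- The point `r_n = ⨁_{i=1}^n e_1∧…∧e_i ∈ W_n` in coordinates. -/
def rPoint (n : ℕ) : RIdx n → ℂ := fun x => rComp x.1 x.2

/-- The action of `g` on `W_n` (componentwise, via the exterior powers of the standard
action of `SL_n(ℂ)` on `ℂ^n`), so that `g·r_n = ⨁_{i=1}^n (g e_1)∧…∧(g e_i)`. -/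
def rAct (n : ℕ) (g : Matrix (Fin n) (Fin n) ℂ) (x : RIdx n → ℂ) : RIdx n → ℂ :=
  fun r => ∑ D' : SubK n ((r.1 : ℕ) + 1), gminor _ g r.2 D' * x ⟨r.1, D'⟩

/-- The `SL_n(ℂ)`-orbit `Z` of `r_n` in `W_n`. -/
def orbitR (n : ℕ) : Set (RIdx n → ℂ) :=
  {x | ∃ g : Matrix.SpecialLinearGroup (Fin n) ℂ, x = rAct n g.val (rPoint n)}

section Dimension

theorem ringKrullDim_le_of_isIntegral (R S : Type*) [CommRing R] [CommRing S] [Algebra R S]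
    [Algebra.IsIntegral R S] : ringKrullDim S ≤ ringKrullDim R :=
  Order.krullDim_le_of_strictMono (PrimeSpectrum.comap (algebraMap R S))
    fun _ _ h => Ideal.IsIntegral.comap_lt_comap (R := R) h

theorem ringKrullDim_ge_of_isIntegral (R S : Type*) [CommRing R] [CommRing S] [Algebra R S]
    [Algebra.IsIntegral R S] [FaithfulSMul R S] : ringKrullDim R ≤ ringKrullDim S := by
  refine iSup_le fun l => ?_
  obtain ⟨⟨Q, hQ, hQl⟩⟩ := Ideal.nonempty_primesOver (S := S) l.head.asIdeal
  obtain ⟨L, hL, -⟩ := Ideal.exists_ltSeries_of_hasGoingUp l Q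
  rw [← hL]
  exact Order.LTSeries.length_le_krullDim L

theorem exists_noether_normalization_krullDim (k A : Type*) [Field k] [CommRing A] [Nontrivial A]
    [Algebra k A] [Algebra.FiniteType k A] :
    ∃ s : ℕ, ∃ g : MvPolynomial (Fin s) k →ₐ[k] A,
      Function.Injective g ∧ g.IsIntegral ∧ ringKrullDim A = s := by
  obtain ⟨s, g, hg, hi⟩ := exists_integral_inj_algHom_of_fg k A
  refine ⟨s, g, hg, hi, ?_⟩
  algebraize [g.toRingHom]
  have : FaithfulSMul (MvPolynomial (Fin s) k) A :=
    (faithfulSMul_iff_algebraMap_injective _ _).2 hg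
  have h := le_antisymm (ringKrullDim_le_of_isIntegral (MvPolynomial (Fin s) k) A)
    (ringKrullDim_ge_of_isIntegral (MvPolynomial (Fin s) k) A)
  rw [h, MvPolynomial.ringKrullDim_of_isNoetherianRing, ringKrullDim_eq_zero_of_field]
  simp

theorem ringKrullDim_le_card_of_injective {k A P : Type*} [Field k] [CommRing A]
    [Algebra k A] [Algebra.FiniteType k A] [Fintype P] (f : A →ₐ[k] MvPolynomial P k)
    (hf : Function.Injective f) : ringKrullDim A ≤ Fintype.card P := by
  have : Nontrivial A := f.toRingHom.domain_nontrivial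
  obtain ⟨s, g, hg, -, hs⟩ := exists_noether_normalization_krullDim k A
  have h := lift_trdeg_le_of_injective (f.comp g) (hf.comp hg)
  rw [MvPolynomial.trdeg_of_isDomain, MvPolynomial.trdeg_of_isDomain] at h
  simp only [Cardinal.mk_fintype, Fintype.card_fin, Cardinal.lift_natCast, Nat.cast_le] at h
  rw [hs]
  exact_mod_cast h

theorem card_le_ringKrullDim_of_injective_of_isDomain {k A P : Type*} [Field k] [CommRing A]
    [IsDomain A] [Algebra k A] [Algebra.FiniteType k A] [Fintype P] (f : MvPolynomial P k →ₐ[k] A)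
    (hf : Function.Injective f) : Fintype.card P ≤ ringKrullDim A := by
  obtain ⟨s, g, hg, hi, hs⟩ := exists_noether_normalization_krullDim k A
  have h := lift_trdeg_le_of_injective f hf
  algebraize [g.toRingHom]
  have : FaithfulSMul (MvPolynomial (Fin s) k) A :=
    (faithfulSMul_iff_algebraMap_injective _ _).2 hg
  have : IsScalarTower k (MvPolynomial (Fin s) k) A := .of_algHom g
  have h2 := lift_trdeg_add_eq k (MvPolynomial (Fin s) k) A
  rw [trdeg_eq_zero (R := MvPolynomial (Fin s) k), MvPolynomial.trdeg_of_isDomain] at h2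
  rw [MvPolynomial.trdeg_of_isDomain] at h
  simp only [Cardinal.mk_fintype, Fintype.card_fin, Cardinal.lift_natCast, Cardinal.lift_zero,
    add_zero] at h h2
  have h3 : Algebra.trdeg k A = (s : Cardinal) := by
    rw [← Cardinal.lift_inj, ← h2]; simp
  rw [h3] at h
  simp only [Cardinal.lift_natCast, Nat.cast_le] at h
  rw [hs]
  exact_mod_cast h

theorem card_le_ringKrullDim_of_injective {k A P : Type*} [Field k] [CommRing A]
    [Algebra k A] [Algebra.FiniteType k A] [Fintype P] (f : MvPolynomial P k →ₐ[k] A)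
    (hf : Function.Injective f) : Fintype.card P ≤ ringKrullDim A := by
  obtain ⟨Q, hQ, hQf⟩ := Ideal.exists_comap_eq_of_mem_minimalPrimes_of_injective
    (f := f.toRingHom) hf ⊥ (by simp [IsDomain.minimalPrimes_eq_singleton_bot])
  refine (card_le_ringKrullDim_of_injective_of_isDomain
    ((Ideal.Quotient.mkₐ k Q).comp f) ?_).trans (ringKrullDim_quotient_le Q)
  rw [injective_iff_map_eq_zero]
  intro p hp
  have hpQ : f p ∈ Q := Ideal.Quotient.eq_zero_iff_mem.1 hp
  have : p ∈ Ideal.comap f.toRingHom Q := hpQ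
  rwa [hQf] at this

theorem ringKrullDim_quotient_le_of_iInf_le {R : Type*} [CommRing R] {T : Type*} [Finite T]
    (I : Ideal R) (J : T → Ideal R) (h : ⨅ t, J t ≤ I) (d : WithBot ℕ∞)
    (hd : ∀ t, ringKrullDim (R ⧸ J t) ≤ d) : ringKrullDim (R ⧸ I) ≤ d := by
  rw [ringKrullDim_quotient]
  refine iSup_le fun l => ?_
  obtain ⟨t, ht⟩ : ∃ t, J t ≤ l.head.1.asIdeal := by
    have := Fintype.ofFinite T
    have h1 : Finset.univ.inf J ≤ l.head.1.asIdeal := by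
      rw [Finset.inf_univ_eq_iInf]
      exact h.trans l.head.2
    obtain ⟨t, -, ht⟩ := (Ideal.IsPrime.inf_le' l.head.1.2).1 h1
    exact ⟨t, ht⟩
  refine le_trans ?_ (hd t)
  rw [ringKrullDim_quotient]
  let L : LTSeries (PrimeSpectrum.zeroLocus (J t : Set R)) :=
    { length := l.length
      toFun := fun i => ⟨(l i).1, ht.trans (l.head_le i)⟩
      step := fun i => l.step i }
  exact Order.LTSeries.length_le_krullDim L

variable {ι : Type*}

theorem sDim_le_of_forall_mem_range [Finite ι] {T : Type*} [Finite T] {P : T → Type*}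
    [∀ t, Fintype (P t)] (Y : Set (ι → ℂ)) (f : ∀ t, ι → MvPolynomial (P t) ℂ)
    (h : ∀ y ∈ Y, ∃ t, ∃ u : P t → ℂ, ∀ r, y r = MvPolynomial.eval u (f t r)) (d : WithBot ℕ∞)
    (hd : ∀ t, (Fintype.card (P t) : WithBot ℕ∞) ≤ d) : sDim Y ≤ d := by
  refine ringKrullDim_quotient_le_of_iInf_le (vanIdeal Y)
    (fun t => RingHom.ker (MvPolynomial.aeval (R := ℂ) (f t))) ?_ _ fun t => ?_
  · intro p hp y hy
    obtain ⟨t, u, hu⟩ := h y hy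
    have h1 : MvPolynomial.aeval (f t) p = 0 := (Ideal.mem_iInf.1 hp) t
    have h2 : MvPolynomial.aeval u (MvPolynomial.aeval (f t) p) = 0 := by rw [h1, map_zero]
    rw [MvPolynomial.aeval_eq_bind₁, MvPolynomial.aeval_bind₁] at h2
    rw [funext hu]
    simpa [MvPolynomial.aeval_eq_eval] using h2
  · exact (ringKrullDim_le_card_of_injective
      (Ideal.kerLiftAlg (MvPolynomial.aeval (R := ℂ) (f t))) (Ideal.kerLiftAlg_injective _)).trans
      (hd t)

theorem card_le_sDim_of_dominant [Finite ι] {P : Type*} [Fintype P]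
    (Y : Set (ι → ℂ)) (e : P → ι) (q : MvPolynomial P ℂ) (hq : q ≠ 0)
    (h : ∀ u : P → ℂ, MvPolynomial.eval u q ≠ 0 → ∃ y ∈ Y, ∀ p, y (e p) = u p) :
    (Fintype.card P : WithBot ℕ∞) ≤ sDim Y := by
  refine card_le_ringKrullDim_of_injective
    ((Ideal.Quotient.mkₐ ℂ (vanIdeal Y)).comp (MvPolynomial.rename e)) ?_
  rw [injective_iff_map_eq_zero]
  intro p hp
  have hp : MvPolynomial.rename e p ∈ vanIdeal Y := Ideal.Quotient.eq_zero_iff_mem.1 hp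
  have h1 : p * q = 0 := by
    refine MvPolynomial.funext fun u => ?_
    by_cases hu : MvPolynomial.eval u q = 0
    · simp [hu]
    · obtain ⟨y, hy, hyu⟩ := h u hu
      have h2 := hp y hy
      rw [MvPolynomial.eval_rename, show y ∘ e = u from funext hyu] at h2
      simp [h2]
  exact (mul_eq_zero.1 h1).resolve_right hq

end Dimension

section Sequences

variable {n k : ℕ}

/-- The inclusion of the positions `0, …, j` into `Fin n`. -/
def initSeg (j : Fin n) : Fin ((j : ℕ) + 1) → Fin n := Fin.castLE j.isLt

@[simp] theorem initSeg_val (j : Fin n) (a : Fin ((j : ℕ) + 1)) : (initSeg j a : ℕ) = a := rfl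

theorem initSeg_injective (j : Fin n) : Function.Injective (initSeg j) :=
  Fin.castLE_injective _

theorem initSeg_strictMono (j : Fin n) : StrictMono (initSeg j) :=
  Fin.strictMono_castLE _

theorem enumK_strictMono (C : SubK n k) : StrictMono (enumK C) :=
  fun _ _ h => (C.1.orderIsoOfFin C.2).strictMono h

theorem enumK_mem (C : SubK n k) (a : Fin k) : enumK C a ∈ C.1 :=
  (C.1.orderIsoOfFin C.2 a).2

theorem enumK_eq_of_strictMono (C : SubK n k) (f : Fin k → Fin n) (hf : StrictMono f)
    (hm : ∀ a, f a ∈ C.1) : enumK C = f :=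
  (Finset.orderEmbOfFin_unique C.2 hm hf).symm

theorem exists_enumK_eq (C : SubK n k) {y : Fin n} (hy : y ∈ C.1) : ∃ a, enumK C a = y := by
  obtain ⟨a, ha⟩ := (C.1.orderIsoOfFin C.2).surjective ⟨y, hy⟩
  exact ⟨a, congrArg Subtype.val ha⟩

/-- A function on sequences of indices which is alternating. -/
structure IsAltSeq (F : (Fin k → Fin n) → ℂ) : Prop where
  eq_zero : ∀ s, ¬ Function.Injective s → F s = 0
  perm : ∀ s (π : Equiv.Perm (Fin k)), F (s ∘ π) = (Equiv.Perm.sign π : ℤ) * F s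

theorem isAltSeq_det {m : Type*} (M : Matrix (Fin n) m ℂ) (c : Fin k → m) :
    IsAltSeq fun s : Fin k → Fin n => (M.submatrix s c).det where
  eq_zero s hs := by
    simp only [Function.Injective, not_forall] at hs
    obtain ⟨a, b, hab, hne⟩ := hs
    exact Matrix.det_zero_of_row_eq hne (by ext; simp [hab])
  perm s π := Matrix.det_permute π (M.submatrix s c)

theorem exists_eq_enumK_comp (s : Fin k → Fin n) (hs : Function.Injective s) :
    ∃ (C : SubK n k) (π : Equiv.Perm (Fin k)), s = enumK C ∘ π := by
  let C : SubK n k := ⟨Finset.univ.image s, by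
    rw [Finset.card_image_of_injective _ hs, Finset.card_univ, Fintype.card_fin]⟩
  have h : ∀ a, ∃ b, enumK C b = s a := fun a => exists_enumK_eq C (by simp [C])
  choose f hf using h
  have hi : Function.Injective f := fun a b hab => hs (by rw [← hf, ← hf, hab])
  exact ⟨C, Equiv.ofBijective f (Finite.injective_iff_bijective.1 hi),
    funext fun a => (hf a).symm⟩

theorem IsAltSeq.ext {F G : (Fin k → Fin n) → ℂ} (hF : IsAltSeq F) (hG : IsAltSeq G)
    (h : ∀ C : SubK n k, F (enumK C) = G (enumK C)) (s : Fin k → Fin n) : F s = G s := by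
  by_cases hs : Function.Injective s
  · obtain ⟨C, π, rfl⟩ := exists_eq_enumK_comp s hs
    rw [hF.perm, hG.perm, h]
  · rw [hF.eq_zero s hs, hG.eq_zero s hs]

/-- The extension of the `j`-th component of a point of `W_n` from increasing sequences of indices
to all sequences of indices. -/
def seqCoord {R : Type*} [CommRing R] (x : RIdx n → R) (j : Fin n)
    (s : Fin ((j : ℕ) + 1) → Fin n) : R :=
  ∑ D : SubK n ((j : ℕ) + 1),
    x ⟨j, D⟩ * ((((1 : Matrix (Fin n) (Fin n) ℤ).submatrix s (enumK D)).det : ℤ) : R)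

theorem map_seqCoord {R S : Type*} [CommRing R] [CommRing S] (φ : R →+* S) (x : RIdx n → R)
    (j : Fin n) (s : Fin ((j : ℕ) + 1) → Fin n) :
    φ (seqCoord x j s) = seqCoord (fun r => φ (x r)) j s := by
  simp [seqCoord]

theorem intCast_det_one_submatrix (s t : Fin k → Fin n) :
    ((((1 : Matrix (Fin n) (Fin n) ℤ).submatrix s t).det : ℤ) : ℂ) =
      ((1 : Matrix (Fin n) (Fin n) ℂ).submatrix s t).det := by
  refine ((Int.castRingHom ℂ).map_det _).trans ?_
  congr 1
  ext a b
  simp [Matrix.one_apply]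

theorem det_one_submatrix_enumK (C D : SubK n k) :
    ((1 : Matrix (Fin n) (Fin n) ℂ).submatrix (enumK C) (enumK D)).det =
      if C = D then 1 else 0 := by
  split_ifs with h
  · subst h
    rw [Matrix.submatrix_one _ (enumK_strictMono C).injective, Matrix.det_one]
  · obtain ⟨y, hyC, hyD⟩ : ∃ y ∈ C.1, y ∉ D.1 := by
      by_contra! hc
      exact h (Subtype.ext (Finset.eq_of_subset_of_card_le hc (by rw [C.2, D.2])))
    obtain ⟨a, rfl⟩ := exists_enumK_eq C hyC
    refine Matrix.det_eq_zero_of_row_eq_zero a fun b => ?_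
    exact Matrix.one_apply_ne fun hab => hyD (hab ▸ enumK_mem D b)

theorem isAltSeq_seqCoord (x : RIdx n → ℂ) (j : Fin n) : IsAltSeq (seqCoord x j) where
  eq_zero s hs := by
    simp only [seqCoord, intCast_det_one_submatrix]
    refine Finset.sum_eq_zero fun D _ => ?_
    rw [(isAltSeq_det 1 (enumK D)).eq_zero s hs, mul_zero]
  perm s π := by
    simp only [seqCoord, intCast_det_one_submatrix, Finset.mul_sum]
    refine Finset.sum_congr rfl fun D _ => ?_
    rw [(isAltSeq_det 1 (enumK D)).perm s π]
    ring

theorem seqCoord_enumK (x : RIdx n → ℂ) (j : Fin n) (C : SubK n ((j : ℕ) + 1)) :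
    seqCoord x j (enumK C) = x ⟨j, C⟩ := by
  simp [seqCoord, intCast_det_one_submatrix, det_one_submatrix_enumK]

theorem rAct_rPoint (g : Matrix (Fin n) (Fin n) ℂ) (j : Fin n) (C : SubK n ((j : ℕ) + 1)) :
    rAct n g (rPoint n) ⟨j, C⟩ = (g.submatrix (enumK C) (initSeg j)).det := by
  let I : SubK n ((j : ℕ) + 1) := ⟨Finset.Iic j, by simp⟩
  have hI : enumK I = initSeg j := enumK_eq_of_strictMono I _ (initSeg_strictMono j) fun a => by
    simp only [I, Finset.mem_Iic, Fin.le_def, initSeg_val]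
    omega
  have h (D : SubK n ((j : ℕ) + 1)) : rPoint n ⟨j, D⟩ = if D = I then 1 else 0 := by
    rw [← det_one_submatrix_enumK]
    simp only [rPoint, rComp, wedgeBasis, wedgeFam]
    congr 1
    ext a b
    simp [stdVec, Pi.single_apply, Matrix.one_apply, enumK, I]
    rfl
  simp only [rAct, h, mul_ite, mul_one, mul_zero, Finset.sum_ite_eq', Finset.mem_univ, if_true,
    gminor, hI]
  rfl

theorem seqCoord_rAct_rPoint (g : Matrix (Fin n) (Fin n) ℂ) (j : Fin n)
    (s : Fin ((j : ℕ) + 1) → Fin n) :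
    seqCoord (rAct n g (rPoint n)) j s = (g.submatrix s (initSeg j)).det :=
  (isAltSeq_seqCoord _ j).ext (isAltSeq_det g _)
    (fun C => by rw [seqCoord_enumK, rAct_rPoint]) s

end Sequences

section Exchange

variable {n : ℕ}

theorem submatrix_update_row {m k : Type*} [DecidableEq k] (g : Matrix m m ℂ) (s : k → m)
    (c : k → m) (i : k) (y : m) :
    g.submatrix (Function.update s i y) c = (g.submatrix s c).updateRow i fun b => g y (c b) := by
  ext a b
  by_cases h : a = i
  · subst h; simp
  · simp [h]

theorem det_submatrix_update_sum {m k β : Type*} [Fintype k] [DecidableEq k] [Fintype β]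
    (g : Matrix m m ℂ) (s c : k → m) (i : k) (y : m) (z : ℂ) (w : β → ℂ) (t : β → m)
    (h : ∀ a, g y (c a) * z = ∑ b, w b * g (t b) (c a)) :
    (g.submatrix (Function.update s i y) c).det * z =
      ∑ b, w b * (g.submatrix (Function.update s i (t b)) c).det := by
  let φ : (k → ℂ) →ₗ[ℂ] ℂ :=
    (Matrix.detRowAlternating (R := ℂ) (n := k)).toMultilinearMap.toLinearMap (g.submatrix s c) i
  have hφ (x : m) : (g.submatrix (Function.update s i x) c).det = φ fun b => g x (c b) := by
    rw [submatrix_update_row]; rfl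
  have h1 : z • (fun a => g y (c a)) = ∑ b, w b • fun a => g (t b) (c a) := by
    ext a
    simp [← h, mul_comm]
  simp only [hφ]
  rw [mul_comm, ← smul_eq_mul, ← map_smul, h1, map_sum]
  simp

theorem det_submatrix_cramer {m k : Type*} [Fintype k] [DecidableEq k]
    (g : Matrix m m ℂ) (C c : k → m) (y : m) (a : k) :
    g y (c a) * (g.submatrix C c).det =
      ∑ b, (g.submatrix (Function.update C b y) c).det * g (C b) (c a) := by
  have h := congrFun (Matrix.mulVec_cramer (g.submatrix C c)ᵀ fun b => g y (c b)) a
  simp only [Matrix.mulVec, dotProduct, Matrix.cramer_transpose_apply, Matrix.det_transpose,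
    Pi.smul_apply, smul_eq_mul, Matrix.transpose_apply, Matrix.submatrix_apply] at h
  simp only [submatrix_update_row]
  rw [mul_comm, ← h]
  exact Finset.sum_congr rfl fun _ _ => mul_comm _ _

/-- The properties of the sequence coordinates of a point in the closure of the orbit: they are
alternating, satisfy the Plücker and incidence exchange relations, and the last one is
normalized. -/
structure IsFlagSystem (F : ∀ j : Fin n, (Fin ((j : ℕ) + 1) → Fin n) → ℂ) : Prop where
  alt : ∀ j, IsAltSeq (F j)
  exchange : ∀ j j' : Fin n, j ≤ j' → ∀ s i C, F j s * F j' C =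
    ∑ b, F j (Function.update s i (C b)) * F j' (Function.update C b (s i))
  last : ∀ j : Fin n, (j : ℕ) + 1 = n → F j (initSeg j) = 1

theorem det_exchange (g : Matrix (Fin n) (Fin n) ℂ) (j j' : Fin n) (h : j ≤ j')
    (s : Fin ((j : ℕ) + 1) → Fin n) (i : Fin ((j : ℕ) + 1)) (C : Fin ((j' : ℕ) + 1) → Fin n) :
    (g.submatrix s (initSeg j)).det * (g.submatrix C (initSeg j')).det =
      ∑ b, (g.submatrix (Function.update s i (C b)) (initSeg j)).det *
        (g.submatrix (Function.update C b (s i)) (initSeg j')).det := by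
  have key := det_submatrix_update_sum g s (initSeg j) i (s i)
    (g.submatrix C (initSeg j')).det
    (fun b => (g.submatrix (Function.update C b (s i)) (initSeg j')).det) C fun a => by
      have := det_submatrix_cramer g C (initSeg j') (s i) (Fin.castLE (Nat.succ_le_succ h) a)
      exact this
  rw [Function.update_eq_self] at key
  rw [key]
  exact Finset.sum_congr rfl fun _ _ => mul_comm _ _

theorem det_submatrix_initSeg_last (g : Matrix (Fin n) (Fin n) ℂ) (j : Fin n)
    (hj : (j : ℕ) + 1 = n) : (g.submatrix (initSeg j) (initSeg j)).det = g.det := by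
  have hb : Function.Bijective (initSeg j) :=
    (Fintype.bijective_iff_injective_and_card _).2 ⟨initSeg_injective j, by simp [hj]⟩
  exact Matrix.det_submatrix_equiv_self (Equiv.ofBijective _ hb) g

theorem eval_eq_zero_of_mem_zCl {ι : Type*} {Y : Set (ι → ℂ)} {x : ι → ℂ} (hx : x ∈ zCl Y)
    (p : MvPolynomial ι ℂ) (hp : ∀ y ∈ Y, MvPolynomial.eval y p = 0) : MvPolynomial.eval x p = 0 :=
  hx p hp

theorem eval_seqCoord_X (x : RIdx n → ℂ) (j : Fin n) (s : Fin ((j : ℕ) + 1) → Fin n) :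
    MvPolynomial.eval x (seqCoord MvPolynomial.X j s) = seqCoord x j s := by
  rw [map_seqCoord]
  simp

theorem isFlagSystem_of_mem_zCl {x : RIdx n → ℂ} (hx : x ∈ zCl (orbitR n)) :
    IsFlagSystem (seqCoord x) where
  alt := isAltSeq_seqCoord x
  exchange j j' h s i C := by
    have := eval_eq_zero_of_mem_zCl hx
      (seqCoord MvPolynomial.X j s * seqCoord MvPolynomial.X j' C -
        ∑ b, seqCoord MvPolynomial.X j (Function.update s i (C b)) *
          seqCoord MvPolynomial.X j' (Function.update C b (s i))) (by
        rintro _ ⟨g, rfl⟩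
        simp only [map_sub, map_mul, map_sum, eval_seqCoord_X, seqCoord_rAct_rPoint]
        rw [sub_eq_zero]
        exact det_exchange g.val j j' h s i C)
    simpa only [map_sub, map_mul, map_sum, eval_seqCoord_X, sub_eq_zero] using this
  last j hj := by
    have := eval_eq_zero_of_mem_zCl hx (seqCoord MvPolynomial.X j (initSeg j) - 1) (by
      rintro _ ⟨g, rfl⟩
      simp only [map_sub, map_one, eval_seqCoord_X, seqCoord_rAct_rPoint]
      rw [det_submatrix_initSeg_last _ j hj, sub_eq_zero]
      exact g.2)
    simpa only [map_sub, map_one, eval_seqCoord_X, sub_eq_zero] using this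

end Exchange

section Chain

variable {n : ℕ} {F : ∀ j : Fin n, (Fin ((j : ℕ) + 1) → Fin n) → ℂ}

theorem IsAltSeq.injective {k : ℕ} {G : (Fin k → Fin n) → ℂ} (hG : IsAltSeq G)
    {s : Fin k → Fin n} (hs : G s ≠ 0) : Function.Injective s := by
  by_contra h
  exact hs (hG.eq_zero s h)

theorem IsAltSeq.comp_perm_ne_zero {k : ℕ} {G : (Fin k → Fin n) → ℂ} (hG : IsAltSeq G)
    {s : Fin k → Fin n} (hs : G s ≠ 0) (π : Equiv.Perm (Fin k)) : G (s ∘ π) ≠ 0 := by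
  rw [hG.perm]
  refine mul_ne_zero ?_ hs
  rcases Int.units_eq_one_or (Equiv.Perm.sign π) with h | h <;> simp [h]

theorem exists_perm_comp_initSeg_eq (j : Fin n) (s : Fin ((j : ℕ) + 1) → Fin n)
    (hs : Function.Injective s) : ∃ τ : Equiv.Perm (Fin n), ⇑τ ∘ initSeg j = s := by
  let e : {x // x ∈ Set.range (initSeg j)} ≃ {x // x ∈ Set.range s} :=
    (Equiv.ofInjective _ (initSeg_injective j)).symm.trans (Equiv.ofInjective _ hs)
  refine ⟨e.extendSubtype, funext fun a => ?_⟩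
  rw [Function.comp_apply, Equiv.extendSubtype_apply_of_mem e _ ⟨a, rfl⟩]
  have : (⟨initSeg j a, ⟨a, rfl⟩⟩ : {x // x ∈ Set.range (initSeg j)}) =
    Equiv.ofInjective _ (initSeg_injective j) a := rfl
  simp only [e, Equiv.trans_apply, this, Equiv.symm_apply_apply]
  rfl

theorem IsFlagSystem.exists_perm_agree (hF : IsFlagSystem F) {k j : Fin n} (hkj : k < j)
    (σ : Equiv.Perm (Fin n)) (hσ : F k (σ ∘ initSeg k) ≠ 0) (hj : ∃ s, F j s ≠ 0) (m : ℕ)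
    (hm : m ≤ (k : ℕ) + 1) :
    ∃ τ : Equiv.Perm (Fin n), F j (τ ∘ initSeg j) ≠ 0 ∧ ∀ a : Fin n, (a : ℕ) < m → τ a = σ a := by
  induction m with
  | zero =>
    obtain ⟨s, hs⟩ := hj
    obtain ⟨τ, rfl⟩ := exists_perm_comp_initSeg_eq j s ((hF.alt j).injective hs)
    exact ⟨τ, hs, fun a ha => absurd ha (Nat.not_lt_zero _)⟩
  | succ m ih =>
    obtain ⟨τ, hτ, hag⟩ := ih (by omega)
    have hkj' : (k : ℕ) < j := hkj
    have hex := hF.exchange k j hkj.le (σ ∘ initSeg k) ⟨m, by omega⟩ (τ ∘ initSeg j)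
    obtain ⟨b, -, hb⟩ := Finset.exists_ne_zero_of_sum_ne_zero (hex ▸ mul_ne_zero hσ hτ)
    have hb1 := (hF.alt k).injective (left_ne_zero_of_mul hb)
    have hb2 := right_ne_zero_of_mul hb
    have hb2i := (hF.alt j).injective hb2
    set M : Fin n := ⟨m, by omega⟩ with hM
    have hMb : m ≤ (b : ℕ) := by
      by_contra! hlt
      have h1 := @hb1 ⟨b, by omega⟩ ⟨m, by omega⟩
      have hne : (⟨b, by omega⟩ : Fin ((k : ℕ) + 1)) ≠ ⟨m, by omega⟩ := by
        simp only [ne_eq, Fin.mk.injEq]; omega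
      refine hne (h1 ?_)
      rw [Function.update_of_ne hne, Function.update_self]
      exact (hag (initSeg j b) hlt).symm
    let τ₁ : Equiv.Perm (Fin n) := τ.trans (Equiv.swap (τ (initSeg j b)) (σ M))
    have h1 : ⇑τ₁ ∘ initSeg j = Function.update (τ ∘ initSeg j) b (σ M) := by
      funext a
      by_cases hab : a = b
      · subst hab; simp [τ₁]
      · rw [Function.update_of_ne hab]
        refine Equiv.swap_apply_of_ne_of_ne
          (fun h => hab (initSeg_injective j (τ.injective h))) fun h => hab (hb2i ?_)
        rw [Function.update_of_ne hab, Function.update_self]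
        exact h
    let M' : Fin ((j : ℕ) + 1) := ⟨m, by omega⟩
    have h2 : ⇑((Equiv.swap (initSeg j b) M).trans τ₁) ∘ initSeg j =
        (τ₁ ∘ initSeg j) ∘ Equiv.swap b M' := by
      funext a
      simp only [Function.comp_apply, Equiv.trans_apply]
      congr 1
      exact (initSeg_injective j).swap_apply b M' a
    refine ⟨(Equiv.swap (initSeg j b) M).trans τ₁, ?_, fun a ha => ?_⟩
    · rw [h2, h1]
      exact (hF.alt j).comp_perm_ne_zero hb2 _
    · rcases Nat.lt_succ_iff_lt_or_eq.1 ha with ha | ha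
      · have hab : a ≠ initSeg j b := fun h => by
          have := congrArg Fin.val h
          simp only [initSeg_val] at this
          omega
        have haM : a ≠ M := fun h => by
          have := congrArg Fin.val h
          simp only [hM] at this
          omega
        rw [Equiv.trans_apply, Equiv.swap_apply_of_ne_of_ne hab haM, ← hag a ha]
        have h3 := congrFun h1 ⟨a, by omega⟩
        rw [Function.update_of_ne] at h3
        · exact h3
        · intro h
          exact hab (by rw [← h]; rfl)
      · obtain rfl : a = M := Fin.ext ha
        simp [τ₁]

theorem IsFlagSystem.exists_perm (hF : IsFlagSystem F) :
    ∃ σ : Equiv.Perm (Fin n), ∀ j, (∃ s, F j s ≠ 0) → F j (σ ∘ initSeg j) ≠ 0 := by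
  suffices h : ∀ l : ℕ, l ≤ n → ∃ σ : Equiv.Perm (Fin n), ∀ j : Fin n, (j : ℕ) < l →
      (∃ s, F j s ≠ 0) → F j (σ ∘ initSeg j) ≠ 0 by
    obtain ⟨σ, hσ⟩ := h n le_rfl
    exact ⟨σ, fun j => hσ j j.isLt⟩
  intro l
  induction l with
  | zero => exact fun _ => ⟨1, fun j hj => absurd hj (Nat.not_lt_zero _)⟩
  | succ l ih =>
    intro hl
    obtain ⟨σ, hσ⟩ := ih (by omega)
    let j₀ : Fin n := ⟨l, hl⟩
    by_cases hj₀ : ∃ s, F j₀ s ≠ 0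
    swap
    · refine ⟨σ, fun j hj hs => ?_⟩
      rcases Nat.lt_succ_iff_lt_or_eq.1 hj with hj | hj
      · exact hσ j hj hs
      · obtain rfl : j = j₀ := Fin.ext hj
        exact absurd hs hj₀
    obtain ⟨τ, hτ, hag⟩ : ∃ τ : Equiv.Perm (Fin n), F j₀ (τ ∘ initSeg j₀) ≠ 0 ∧
        ∀ j : Fin n, j < j₀ → (∃ s, F j s ≠ 0) → ∀ a ≤ j, τ a = σ a := by
      classical
      let S : Finset (Fin n) := Finset.univ.filter fun j => j < j₀ ∧ ∃ s, F j s ≠ 0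
      by_cases hS : S.Nonempty
      · have hk := S.max'_mem hS
        set k := S.max' hS with hkdef
        obtain ⟨hk1, hk2⟩ : k < j₀ ∧ ∃ s, F k s ≠ 0 := by simpa [S] using hk
        obtain ⟨τ, hτ, hag⟩ := hF.exists_perm_agree hk1 σ (hσ k hk1 hk2) hj₀ _ le_rfl
        refine ⟨τ, hτ, fun j hj hjs a ha => hag a (Nat.lt_succ_of_le ?_)⟩
        exact ha.trans (S.le_max' j (by simp [S, hj, hjs]))
      · obtain ⟨s, hs⟩ := hj₀
        obtain ⟨τ, rfl⟩ := exists_perm_comp_initSeg_eq j₀ s ((hF.alt j₀).injective hs)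
        exact ⟨τ, hs, fun j hj hjs => absurd ⟨j, by simp [S, hj, hjs]⟩ hS⟩
    refine ⟨τ, fun j hj hs => ?_⟩
    rcases Nat.lt_succ_iff_lt_or_eq.1 hj with hj | hj
    · have : ⇑τ ∘ initSeg j = σ ∘ initSeg j :=
        funext fun a => hag j hj hs _ (Nat.lt_succ_iff.1 a.isLt)
      rw [this]
      exact hσ j hj hs
    · obtain rfl : j = j₀ := Fin.ext hj
      exact hτ

end Chain

section Decomposition

variable {n : ℕ} {F : ∀ j : Fin n, (Fin ((j : ℕ) + 1) → Fin n) → ℂ}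

theorem eq_zero_of_exchange {k : ℕ} (d : (Fin k → Fin n) → ℂ) (C : Fin k → Fin n)
    (u : Fin k → Fin n → ℂ) (hd : ∀ s i, d s = ∑ b, d (Function.update s i (C b)) * u b (s i))
    (h0 : ∀ f : Fin k → Fin k, d (C ∘ f) = 0) (s : Fin k → Fin n) : d s = 0 := by
  suffices h : ∀ (T : Finset (Fin k)) (s : Fin k → Fin n), (∀ i ∉ T, s i ∈ Set.range C) →
      d s = 0 from h Finset.univ s fun i hi => absurd (Finset.mem_univ i) hi
  intro T
  induction T using Finset.induction_on with
  | empty =>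
    intro s hs
    choose f hf using fun i => hs i (Finset.notMem_empty i)
    rw [← funext hf]
    exact h0 f
  | insert i T _ ih =>
    intro s hs
    rw [hd s i]
    refine Finset.sum_eq_zero fun b _ => ?_
    rw [ih _ fun a ha => ?_, zero_mul]
    by_cases hai : a = i
    · subst hai; simp
    · rw [Function.update_of_ne hai]
      exact hs a (by simp [hai, ha])

theorem det_submatrix_eq_one_of_unipotent (L : Matrix (Fin n) (Fin n) ℂ) (h1 : ∀ a, L a a = 1)
    (h0 : ∀ a b, a < b → L a b = 0) {k : ℕ} (c : Fin k → Fin n) (hc : StrictMono c) :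
    (L.submatrix c c).det = 1 := by
  rw [Matrix.det_of_isLowerTriangular]
  · simp [h1]
  · intro a b hab
    exact h0 _ _ (hc hab)

theorem IsFlagSystem.eq_mul_det (hF : IsFlagSystem F) (σ : Equiv.Perm (Fin n))
    (jf : Fin n → Fin n) (hjf : ∀ b, b ≤ jf b) (hjf0 : ∀ b, F (jf b) (σ ∘ initSeg (jf b)) ≠ 0)
    (L : Matrix (Fin n) (Fin n) ℂ)
    (hL : ∀ a b, L a b = F (jf b) (Function.update (σ ∘ initSeg (jf b))
      ⟨b, Nat.lt_succ_of_le (hjf b)⟩ (σ a)) / F (jf b) (σ ∘ initSeg (jf b)))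
    (h1 : ∀ a, L a a = 1) (h0 : ∀ a b, a < b → L a b = 0)
    (j : Fin n) (hj : F j (σ ∘ initSeg j) ≠ 0) (hjb : ∀ b ≤ j, jf b ≤ j)
    (s : Fin ((j : ℕ) + 1) → Fin n) :
    F j s = F j (σ ∘ initSeg j) * (L.submatrix (σ.symm ∘ s) (initSeg j)).det := by
  set C : Fin ((j : ℕ) + 1) → Fin n := σ ∘ initSeg j with hC
  let u : Fin ((j : ℕ) + 1) → Fin n → ℂ := fun b y => F j (Function.update C b y) / F j C
  let M : Matrix (Fin n) (Fin n) ℂ := L.submatrix σ.symm id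
  have hrow (y : Fin n) (a : Fin ((j : ℕ) + 1)) :
      M y (initSeg j a) * 1 = ∑ b, u b y * M (C b) (initSeg j a) := by
    have hle : jf (initSeg j a) ≤ j := hjb _ (Nat.lt_succ_iff.1 a.isLt)
    have hex := hF.exchange _ j hle (Function.update (σ ∘ initSeg (jf (initSeg j a)))
      ⟨initSeg j a, Nat.lt_succ_of_le (hjf (initSeg j a))⟩ y)
      ⟨initSeg j a, Nat.lt_succ_of_le (hjf (initSeg j a))⟩ C
    simp only [Function.update_idem, Function.update_self] at hex
    simp only [M, u, Matrix.submatrix_apply, id, hL, Equiv.apply_symm_apply, mul_one]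
    rw [div_eq_iff (hjf0 _), Finset.sum_mul]
    rw [← eq_div_iff hj, Finset.sum_div] at hex
    rw [hex]
    refine Finset.sum_congr rfl fun b _ => ?_
    field_simp [hjf0 (initSeg j a)]
  have hM : IsAltSeq fun s : Fin ((j : ℕ) + 1) → Fin n => (M.submatrix s (initSeg j)).det :=
    isAltSeq_det M _
  have hMC : (M.submatrix C (initSeg j)).det = 1 := by
    rw [← det_submatrix_eq_one_of_unipotent L h1 h0 _ (initSeg_strictMono j)]
    congr 1
    ext a b
    simp [M, hC]
  have key := eq_zero_of_exchange (fun s => F j s - F j C * (M.submatrix s (initSeg j)).det) C u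
    (fun s i => ?_) (fun f => ?_) s
  · exact sub_eq_zero.1 key
  · have e1 : F j s = ∑ b, F j (Function.update s i (C b)) * u b (s i) := by
      have hex := hF.exchange j j le_rfl s i C
      rw [← eq_div_iff hj, Finset.sum_div] at hex
      rw [hex]
      exact Finset.sum_congr rfl fun b _ => mul_div_assoc _ _ _
    have e2 := det_submatrix_update_sum M s (initSeg j) i (s i) 1 (fun b => u b (s i)) C
      (hrow (s i))
    rw [Function.update_eq_self, mul_one] at e2
    simp only [sub_mul, Finset.sum_sub_distrib]
    rw [← e1, e2, Finset.mul_sum]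
    congr 1
    exact Finset.sum_congr rfl fun b _ => by ring
  · by_cases hf : Function.Injective f
    · let π := Equiv.ofBijective f (Finite.injective_iff_bijective.1 hf)
      have hπ : f = π := rfl
      simp only [hπ]
      rw [(hF.alt j).perm, hM.perm C π, hMC]
      ring
    · have hCf : ¬ Function.Injective (C ∘ f) := fun h => hf h.of_comp
      simp only [(hF.alt j).eq_zero _ hCf, hM.eq_zero _ hCf]
      ring

theorem IsFlagSystem.exists_decomposition (hF : IsFlagSystem F) :
    ∃ (σ : Equiv.Perm (Fin n)) (L : Matrix (Fin n) (Fin n) ℂ) (c : Fin n → ℂ),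
      (∀ a, L a a = 1) ∧ (∀ a b, a < b → L a b = 0) ∧
      (∀ j : Fin n, (j : ℕ) + 1 = n → c j = (Equiv.Perm.sign σ : ℤ)) ∧
      (∀ i i' : Fin n, (i : ℕ) + 1 = i' → c i = 0 → L i' i = 0) ∧
      ∀ j s, F j s = c j * (L.submatrix (σ.symm ∘ s) (initSeg j)).det := by
  obtain ⟨σ, hσ⟩ := hF.exists_perm
  have hσ' (j : Fin n) (h : F j (σ ∘ initSeg j) = 0) (s) : F j s = 0 := by
    by_contra hs
    exact hσ j ⟨s, hs⟩ h
  have hlast (j : Fin n) (hj : (j : ℕ) + 1 = n) :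
      F j (σ ∘ initSeg j) = (Equiv.Perm.sign σ : ℤ) := by
    have hb : Function.Bijective (initSeg j) :=
      (Fintype.bijective_iff_injective_and_card _).2 ⟨initSeg_injective j, by simp [hj]⟩
    let e := Equiv.ofBijective _ hb
    have h : ⇑σ ∘ initSeg j = initSeg j ∘ (e.trans (σ.trans e.symm)) := by
      funext a
      exact (e.apply_symm_apply (σ (e a))).symm
    rw [h, (hF.alt j).perm, hF.last j hj, mul_one]
    congr 2
    exact Equiv.Perm.sign_trans_trans_symm σ e
  have hex (b : Fin n) : ∃ j, (b ≤ j ∧ F j (σ ∘ initSeg j) ≠ 0) ∧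
      ∀ j', b ≤ j' → F j' (σ ∘ initSeg j') ≠ 0 → j ≤ j' := by
    classical
    let S : Finset (Fin n) := Finset.univ.filter fun j => b ≤ j ∧ F j (σ ∘ initSeg j) ≠ 0
    have hS : S.Nonempty := by
      have hb := b.isLt
      refine ⟨⟨n - 1, by omega⟩, ?_⟩
      simp only [S, Finset.mem_filter, Finset.mem_univ, true_and]
      refine ⟨Fin.le_def.2 (by simp only; omega), ?_⟩
      rw [hlast _ (by simp only; omega)]
      simp
    refine ⟨S.min' hS, by simpa [S] using S.min'_mem hS, fun j' h1 h2 => S.min'_le _ ?_⟩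
    simp only [S, Finset.mem_filter, Finset.mem_univ, true_and]
    exact ⟨h1, h2⟩
  choose jf hjf hmin using hex
  let L : Matrix (Fin n) (Fin n) ℂ := Matrix.of fun a b =>
    F (jf b) (Function.update (σ ∘ initSeg (jf b)) ⟨b, Nat.lt_succ_of_le (hjf b).1⟩ (σ a)) /
      F (jf b) (σ ∘ initSeg (jf b))
  have h1 (a : Fin n) : L a a = 1 := by
    have : Function.update (σ ∘ initSeg (jf a)) ⟨a, Nat.lt_succ_of_le (hjf a).1⟩ (σ a) =
        σ ∘ initSeg (jf a) := Function.update_eq_self _ _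
    simp only [L, Matrix.of_apply, this]
    exact div_self (hjf a).2
  have h0 (a b : Fin n) (hab : a ≠ b) (ha : a ≤ jf b) : L a b = 0 := by
    simp only [L, Matrix.of_apply]
    rw [(hF.alt (jf b)).eq_zero, zero_div]
    intro hinj
    have hne : (⟨a, Nat.lt_succ_of_le ha⟩ : Fin ((jf b : ℕ) + 1)) ≠
        ⟨b, Nat.lt_succ_of_le (hjf b).1⟩ := fun h =>
          hab (Fin.ext (by simpa only [Fin.mk.injEq] using h))
    refine hne (hinj ?_)
    rw [Function.update_of_ne hne, Function.update_self]
    rfl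
  have h0' (a b : Fin n) (hab : a < b) : L a b = 0 :=
    h0 a b hab.ne (hab.le.trans (hjf b).1)
  refine ⟨σ, L, fun j => F j (σ ∘ initSeg j), h1, h0', hlast, fun i i' hi hc => ?_, fun j s => ?_⟩
  · refine h0 i' i (fun h => by rw [h] at hi; omega) ?_
    have hne : i ≠ jf i := fun h => (hjf i).2 (by rw [← h]; exact hc)
    have := lt_of_le_of_ne (hjf i).1 hne
    rw [Fin.lt_def] at this
    rw [Fin.le_def]
    omega
  · by_cases hj : F j (σ ∘ initSeg j) = 0
    · rw [hσ' j hj s]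
      simp [hj]
    · exact hF.eq_mul_det σ jf (fun b => (hjf b).1) (fun b => (hjf b).2) L (fun _ _ => rfl) h1 h0'
        j hj (fun b hb => hmin b j hb hj) s

end Decomposition

section Parametrization

variable {n : ℕ}

/-- The lower unitriangular matrix with entries `t (a, b)` below the diagonal. -/
def unitri {R : Type*} [CommRing R] (t : Fin n × Fin n → R) : Matrix (Fin n) (Fin n) R :=
  Matrix.of fun a b => if a = b then 1 else if b < a then t (a, b) else 0

/-- The point of `W_n` whose `j`-th component is `t (j, j)` (or the sign of `σ` for the last `j`)
times the wedge of the first columns of the row permutation by `σ` of `unitri t`. -/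
def flagParam {R : Type*} [CommRing R] (σ : Equiv.Perm (Fin n)) (t : Fin n × Fin n → R)
    (r : RIdx n) : R :=
  (if (r.1 : ℕ) + 1 < n then t (r.1, r.1) else ((Equiv.Perm.sign σ : ℤ) : R)) *
    ((unitri t).submatrix (σ.symm ∘ enumK r.2) (initSeg r.1)).det

theorem map_flagParam {R S : Type*} [CommRing R] [CommRing S] (φ : R →+* S)
    (σ : Equiv.Perm (Fin n)) (t : Fin n × Fin n → R) (r : RIdx n) :
    φ (flagParam σ t r) = flagParam σ (fun p => φ (t p)) r := by
  simp only [flagParam, map_mul, apply_ite φ, map_intCast]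
  congr 1
  rw [RingHom.map_det]
  congr 1
  ext a b
  simp only [unitri, RingHom.mapMatrix_apply, Matrix.map_apply, Matrix.submatrix_apply,
    Matrix.of_apply, apply_ite φ, map_one, map_zero]

theorem flagParam_congr {R : Type*} [CommRing R] (σ : Equiv.Perm (Fin n))
    {t t' : Fin n × Fin n → R}
    (h : ∀ p : Fin n × Fin n, p.2 ≤ p.1 → (p.2 : ℕ) + 1 < n → t p = t' p) :
    flagParam σ t = flagParam σ t' := by
  have hL : unitri t = unitri t' := by
    ext a b
    simp only [unitri, Matrix.of_apply]
    split_ifs with h1 h2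
    · rfl
    · exact h (a, b) h2.le (by have := a.isLt; rw [Fin.lt_def] at h2; simp only; omega)
    · rfl
  funext r
  simp only [flagParam, hL]
  split_ifs with hr
  · rw [h (r.1, r.1) le_rfl hr]
  · rfl

theorem unitri_self (t : Fin n × Fin n → ℂ) (a : Fin n) : unitri t a a = 1 := by
  simp [unitri]

theorem unitri_of_lt (t : Fin n × Fin n → ℂ) (a b : Fin n) (h : a < b) : unitri t a b = 0 := by
  simp [unitri, h.ne, h.not_gt]

theorem exists_eq_flagParam {x : RIdx n → ℂ} (hx : x ∈ zCl (orbitR n)) :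
    ∃ (σ : Equiv.Perm (Fin n)) (t : Fin n × Fin n → ℂ), x = flagParam σ t ∧
      ∀ i i' : Fin n, (i : ℕ) + 1 = i' → t (i, i) = 0 → t (i', i) = 0 := by
  obtain ⟨σ, L, c, h1, h0, hc, hz, hx'⟩ := (isFlagSystem_of_mem_zCl hx).exists_decomposition
  let t : Fin n × Fin n → ℂ := fun p => if p.1 = p.2 then c p.1 else L p.1 p.2
  have hL : unitri t = L := by
    ext a b
    simp only [unitri, t, Matrix.of_apply]
    split_ifs with hab hba
    · rw [hab, h1]
    · rfl
    · exact (h0 a b (lt_of_le_of_ne (not_lt.1 hba) hab)).symm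
  refine ⟨σ, t, funext fun r => ?_, fun i i' hi h => ?_⟩
  · rw [← seqCoord_enumK x r.1 r.2, hx']
    simp only [flagParam, hL]
    congr 1
    split_ifs with hr
    · simp [t]
    · exact hc _ (by have := r.1.isLt; omega)
  · have hne : i' ≠ i := fun h => by rw [h] at hi; omega
    simp only [t, if_true] at h
    simp only [t, hne, if_false]
    exact hz i i' hi h

theorem flagParam_mem_orbitR (hn : 1 ≤ n) (σ : Equiv.Perm (Fin n)) (t : Fin n × Fin n → ℂ)
    (ht : ∀ j : Fin n, (j : ℕ) + 1 < n → t (j, j) ≠ 0) : flagParam σ t ∈ orbitR n := by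
  let c : Fin n → ℂ := fun j =>
    if (j : ℕ) + 1 < n then t (j, j) else ((Equiv.Perm.sign σ : ℤ) : ℂ)
  let c' : ℕ → ℂ := fun k => if h : 0 < k ∧ k - 1 < n then c ⟨k - 1, h.2⟩ else 1
  have hc (j : Fin n) : c j ≠ 0 := by
    simp only [c]
    split_ifs with h
    · exact ht j h
    · simp
  have hc' (k : ℕ) : c' k ≠ 0 := by
    simp only [c']
    split_ifs with h
    · exact hc _
    · exact one_ne_zero
  have hprod (m : ℕ) : ∏ k ∈ Finset.range m, c' (k + 1) / c' k = c' m := by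
    induction m with
    | zero => simp [c']
    | succ m ih => rw [Finset.prod_range_succ, ih, mul_div_cancel₀ _ (hc' m)]
  let d : Fin n → ℂ := fun b => c' (b + 1) / c' b
  have hd (j : Fin n) : ∏ a, d (initSeg j a) = c j := by
    have : ∏ a, d (initSeg j a) = ∏ k ∈ Finset.range ((j : ℕ) + 1), c' (k + 1) / c' k :=
      Fin.prod_univ_eq_prod_range (fun k => c' (k + 1) / c' k) _
    rw [this, hprod]
    simp [c']
  let g : Matrix (Fin n) (Fin n) ℂ := Matrix.of fun a b => d b * unitri t (σ.symm a) b
  have hg (j : Fin n) (s : Fin ((j : ℕ) + 1) → Fin n) : (g.submatrix s (initSeg j)).det =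
      c j * ((unitri t).submatrix (σ.symm ∘ s) (initSeg j)).det := by
    rw [← hd j, ← Matrix.det_mul_row]
    rfl
  have hdet : g.det = 1 := by
    let l : Fin n := ⟨n - 1, by omega⟩
    have hl : (l : ℕ) + 1 = n := by simp only [l]; omega
    have hU : (unitri t).det = 1 := by
      simpa using
        det_submatrix_eq_one_of_unipotent _ (unitri_self t) (unitri_of_lt t) id strictMono_id
    have h1 : ((unitri t).submatrix σ.symm id).det = ((Equiv.Perm.sign σ : ℤ) : ℂ) := by
      rw [Matrix.det_permute, hU, Equiv.Perm.sign_symm, mul_one]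
    rw [← det_submatrix_initSeg_last g l hl, hg]
    have h2 := det_submatrix_initSeg_last ((unitri t).submatrix σ.symm id) l hl
    rw [h1, Matrix.submatrix_submatrix] at h2
    rw [Function.id_comp] at h2
    rw [h2]
    have hcl : c l = ((Equiv.Perm.sign σ : ℤ) : ℂ) := by simp [c, hl]
    rw [hcl]
    rcases Int.units_eq_one_or (Equiv.Perm.sign σ) with h | h <;> simp [h]
  exact ⟨⟨g, hdet⟩, funext fun r => ((rAct_rPoint g r.1 r.2).trans (hg r.1 _)).symm⟩

/-- The parameters of `flagParam`. -/
abbrev IsParam (p : Fin n × Fin n) : Prop := p.2 ≤ p.1 ∧ (p.2 : ℕ) + 1 < n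

/-- The parameters of `flagParam` which may be nonzero when the `i`-th component vanishes. -/
abbrev IsBoundaryParam (i : Fin n) (p : Fin n × Fin n) : Prop :=
  IsParam p ∧ ¬ (p.2 = i ∧ (p.1 : ℕ) ≤ i + 1)

theorem card_isBoundaryParam (i : Fin n) (hi : (i : ℕ) + 1 < n) :
    Fintype.card {p : Fin n × Fin n // IsBoundaryParam i p} + 2 =
      Fintype.card {p : Fin n × Fin n // IsParam p} := by
  have h : (Finset.univ.filter fun p : Fin n × Fin n =>
      IsParam p ∧ (p.2 = i ∧ (p.1 : ℕ) ≤ i + 1)) = {(i, i), (⟨i + 1, hi⟩, i)} := by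
    ext ⟨a, b⟩
    simp only [Finset.mem_filter, Finset.mem_univ, true_and, Finset.mem_insert,
      Finset.mem_singleton, Prod.mk.injEq, IsParam, Fin.le_def, Fin.ext_iff]
    omega
  have h2 : (Finset.univ.filter fun p : Fin n × Fin n =>
      IsParam p ∧ (p.2 = i ∧ (p.1 : ℕ) ≤ i + 1)).card = 2 := by
    rw [h, Finset.card_pair]
    simp [Fin.ext_iff]
  rw [Fintype.card_subtype, Fintype.card_subtype, ← h2, add_comm,
    ← Finset.card_filter_add_card_filter_not (s := Finset.univ.filter fun p => IsParam p)
      fun p : Fin n × Fin n => p.2 = i ∧ (p.1 : ℕ) ≤ i + 1, Finset.filter_filter,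
    Finset.filter_filter]

theorem exists_eval_flagParam {x : RIdx n → ℂ} (hn : 1 ≤ n) (hx : x ∈ zCl (orbitR n) \ orbitR n) :
    ∃ (T : Equiv.Perm (Fin n) × {i : Fin n // (i : ℕ) + 1 < n})
      (u : {p : Fin n × Fin n // IsBoundaryParam T.2.1 p} → ℂ),
      ∀ r, x r = MvPolynomial.eval u (flagParam T.1
        (fun p => if h : IsBoundaryParam T.2.1 p then MvPolynomial.X ⟨p, h⟩ else 0) r) := by
  obtain ⟨σ, t, rfl, ht⟩ := exists_eq_flagParam hx.1
  obtain ⟨i, hi, hti⟩ : ∃ i : Fin n, (i : ℕ) + 1 < n ∧ t (i, i) = 0 := by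
    by_contra! h
    exact hx.2 (flagParam_mem_orbitR hn σ t h)
  refine ⟨(σ, ⟨i, hi⟩), fun p => t p.1, fun r => ?_⟩
  rw [map_flagParam]
  refine congrFun (flagParam_congr σ fun p hp hp' => ?_) r
  split_ifs with h
  · simp
  · obtain ⟨h1, h2⟩ : p.2 = i ∧ (p.1 : ℕ) ≤ i + 1 := by
      by_contra hc
      exact h ⟨⟨hp, hp'⟩, hc⟩
    obtain ⟨a, b⟩ := p
    simp only at h1 h2 hp
    subst h1
    rw [map_zero]
    rcases eq_or_ne a b with rfl | hab
    · exact hti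
    · refine ht b a ?_ hti
      rw [Fin.le_def] at hp
      rw [Ne, Fin.ext_iff] at hab
      omega

theorem exists_mem_orbitR_of_param (hn : 1 ≤ n) (u : {p : Fin n × Fin n // IsParam p} → ℂ)
    (hu : ∀ (j : Fin n) (hj : (j : ℕ) + 1 < n), u ⟨(j, j), le_rfl, hj⟩ ≠ 0) :
    ∃ y ∈ orbitR n, ∀ p : {p : Fin n × Fin n // IsParam p},
      y ⟨p.1.2, insert p.1.1 (Finset.Iio p.1.2), by
        rw [Finset.card_insert_of_notMem (by simpa using p.2.1), Fin.card_Iio]⟩ = u p := by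
  let t : Fin n × Fin n → ℂ := fun p => if h : IsParam p then
    (if p.1 = p.2 then u ⟨p, h⟩ else u ⟨p, h⟩ / u ⟨(p.2, p.2), le_rfl, h.2⟩) else 0
  have ht (a : Fin n) (h : IsParam (a, a)) : t (a, a) = u ⟨(a, a), h⟩ := by
    simp only [t]
    rw [dif_pos h, if_pos trivial]
  have ht' (a b : Fin n) (hab : a ≠ b) (h : IsParam (a, b)) :
      t (a, b) = u ⟨(a, b), h⟩ / u ⟨(b, b), le_rfl, h.2⟩ := by
    simp only [t]
    rw [dif_pos h, if_neg hab]
  refine ⟨flagParam 1 t, flagParam_mem_orbitR hn 1 t fun j hj => ?_, ?_⟩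
  · rw [ht j ⟨le_rfl, hj⟩]
    exact hu j hj
  rintro ⟨⟨a, b⟩, hp⟩
  obtain ⟨hab : b ≤ a, hb : (b : ℕ) + 1 < n⟩ := hp
  let f : Fin ((b : ℕ) + 1) → Fin n := fun i => if (i : ℕ) < b then initSeg b i else a
  have hf : StrictMono f := by
    intro i j hij
    rw [Fin.le_def] at hab
    have := j.isLt
    rw [Fin.lt_def] at hij
    simp only [f, Fin.lt_def]
    split_ifs <;> (try simp only [initSeg_val]) <;> omega
  have hE := enumK_eq_of_strictMono (k := (b : ℕ) + 1) ⟨insert a (Finset.Iio b), by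
    rw [Finset.card_insert_of_notMem (by simpa using hab), Fin.card_Iio]⟩ f hf fun i => by
      simp only [f]
      split_ifs with h
      · exact Finset.mem_insert_of_mem (Finset.mem_Iio.2 h)
      · exact Finset.mem_insert_self _ _
  have hdet : ((unitri t).submatrix f (initSeg b)).det = unitri t a b := by
    rw [Matrix.det_of_isLowerTriangular, Fin.prod_univ_castSucc]
    · have h1 (i : Fin (b : ℕ)) : f i.castSucc = initSeg b i.castSucc := by simp [f]
      have h2 : f (Fin.last b) = a := by simp [f]
      have h3 : initSeg b (Fin.last b) = b := rfl
      simp only [Matrix.submatrix_apply, h1, h2, h3, unitri_self, Finset.prod_const_one, one_mul]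
    · intro i j hij
      refine unitri_of_lt _ _ _ ?_
      have hij' : (i : ℕ) < j := hij
      have := j.isLt
      have hi : (i : ℕ) < b := by omega
      simp only [f, hi, if_true]
      exact hij
  have hpb : IsParam (b, b) := ⟨le_rfl, hb⟩
  have hpa : IsParam (a, b) := ⟨hab, hb⟩
  simp only [flagParam, hb, if_true, hE]
  change t (b, b) * ((unitri t).submatrix f (initSeg b)).det = _
  rw [hdet]
  simp only [unitri, Matrix.of_apply]
  rcases eq_or_lt_of_le hab with rfl | hlt
  · rw [if_pos rfl, mul_one, ht b hpb]
  · rw [if_neg hlt.ne', if_pos hlt, ht b hpb, ht' a b hlt.ne' hpa]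
    exact mul_div_cancel₀ _ (hu b hb)

end Parametrization

/-- Let `Z ⊆ W_n` be the `SL_n(ℂ)`-orbit of
`r_n = ⨁_{i=1}^n e_1∧…∧e_i` and `Z̄` its Zariski closure. Then
`dim(Z̄ ∖ Z) + 2 ≤ dim(Z)`: the boundary of the orbit of `r_n` has codimension at least
two. -/
theorem stmt18 {n : ℕ} (hn : 1 ≤ n) :
    sDim (zCl (orbitR n) \ orbitR n) + 2 ≤ sDim (orbitR n) := by
  classical
  have hlow : (Fintype.card {p : Fin n × Fin n // IsParam p} : WithBot ℕ∞) ≤ sDim (orbitR n) := by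
    refine card_le_sDim_of_dominant (orbitR n)
      (fun p => ⟨p.1.2, insert p.1.1 (Finset.Iio p.1.2), by
        rw [Finset.card_insert_of_notMem (by simpa using p.2.1), Fin.card_Iio]⟩)
      (∏ j : {j : Fin n // (j : ℕ) + 1 < n},
        MvPolynomial.X (R := ℂ) (⟨(j.1, j.1), le_rfl, j.2⟩ : {p : Fin n × Fin n // IsParam p}))
      (Finset.prod_ne_zero_iff.2 fun j _ => MvPolynomial.X_ne_zero _) fun u hu => ?_
    refine exists_mem_orbitR_of_param hn u fun j hj h => hu ?_
    rw [map_prod]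
    refine Finset.prod_eq_zero (Finset.mem_univ ⟨j, hj⟩) ?_
    rw [MvPolynomial.eval_X]
    exact h
  have hup (d : WithBot ℕ∞) (hd : ∀ i : Fin n, (i : ℕ) + 1 < n →
      (Fintype.card {p : Fin n × Fin n // IsBoundaryParam i p} : WithBot ℕ∞) ≤ d) :
      sDim (zCl (orbitR n) \ orbitR n) ≤ d :=
    sDim_le_of_forall_mem_range _ _ (fun x hx => exists_eval_flagParam hn hx) d
      fun T => hd T.2.1 T.2.2
  by_cases h : 1 < n
  · have h0 := card_isBoundaryParam (⟨0, by omega⟩ : Fin n) (by simpa using h)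
    refine le_trans ?_ hlow
    rw [← h0, Nat.cast_add]
    refine add_le_add_left (hup _ fun i hi => ?_) _
    have hi' := card_isBoundaryParam i hi
    exact_mod_cast (by omega)
  · have := hup ⊥ fun i hi => by have := i.isLt; omega
    rw [le_bot_iff.1 this]
    exact bot_le

end
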